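/- A function Q ∈ S^{km}_{ℓ;ν}(ℝ^{2n+1}) satisfies L_{X_h} Q = 0 for every smooth function h on ℝ^{2n+1} — i.e. Q is invariant under all contact vector fields of (ℝ^{2n+1}, α) — if and only if Q is a linear combination of the monomials u_1^a u_2^b u_3^c L_1^f over all (a,b,c,f) ∈ ℕ^4 satisfying a+f = k, b+f = m, a+b+c = ℓ, and f−c = (n+1)ν. (This is the statement, over a Darboux chart, that u_1, u_2, u_3 and L_1 generate the algebra of contact-invariant fields.) -/

import Mathlib

set_option linter.unusedVariables false

open scoped BigOperators

noncomputable section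

/-- Partial derivative of `f : ℝ^ι → ℝ` in the `i`-th coordinate direction. -/
def pd {ι : Type*} [Fintype ι] [DecidableEq ι] (i : ι) (f : (ι → ℝ) → ℝ) (x : ι → ℝ) : ℝ :=
  fderiv ℝ f x (Pi.single i 1)

/-- Index of the coordinate `p_i` in `ℝ^{2n+1}`. -/
def pIdx (n : ℕ) (i : Fin n) : Fin (2*n+1) := ⟨i.1, by have := i.isLt; omega⟩
/-- Index of the coordinate `q^i` in `ℝ^{2n+1}`. -/
def qIdx (n : ℕ) (i : Fin n) : Fin (2*n+1) := ⟨n + i.1, by have := i.isLt; omega⟩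
/-- Index of the coordinate `t` in `ℝ^{2n+1}`. -/
def tIdx (n : ℕ) : Fin (2*n+1) := ⟨2*n, by omega⟩

/-- The contact Hamiltonian vector field `X_h` of a function `h` on `ℝ^{2n+1}`:
`X_h = Σ_k (∂_{p_k}h ∂_{q^k} − ∂_{q^k}h ∂_{p_k}) + (ℰ_s h)∂_t − (∂_t h)ℰ_s − 2h∂_t`. -/
def contactHam (n : ℕ) (h : (Fin (2*n+1) → ℝ) → ℝ) (x : Fin (2*n+1) → ℝ) :
    Fin (2*n+1) → ℝ :=
  fun a =>
    if ha : a.1 < n then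
      -pd (qIdx n ⟨a.1, ha⟩) h x - pd (tIdx n) h x * x a
    else if ha' : a.1 < 2*n then
      pd (pIdx n ⟨a.1 - n, by omega⟩) h x - pd (tIdx n) h x * x a
    else
      (∑ k : Fin n, (x (pIdx n k) * pd (pIdx n k) h x + x (qIdx n k) * pd (qIdx n k) h x))
        - 2 * h x

/-- Points of `ℝ^{2n+1}`. -/
abbrev Vc (n : ℕ) : Type := Fin (2*n+1) → ℝ

/-- Partial derivative in the base variable `x`. -/
def pdX (n : ℕ) (i : Fin (2*n+1)) (Q : Vc n → Vc n → Vc n → Vc n → ℝ)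
    (x ξ η Y : Vc n) : ℝ :=
  fderiv ℝ (fun y => Q y ξ η Y) x (Pi.single i 1)

/-- Partial derivative in the fiber variable `ξ`. -/
def pdXi (n : ℕ) (i : Fin (2*n+1)) (Q : Vc n → Vc n → Vc n → Vc n → ℝ)
    (x ξ η Y : Vc n) : ℝ :=
  fderiv ℝ (fun ζ => Q x ζ η Y) ξ (Pi.single i 1)

/-- Partial derivative in the fiber variable `η`. -/
def pdEta (n : ℕ) (i : Fin (2*n+1)) (Q : Vc n → Vc n → Vc n → Vc n → ℝ)
    (x ξ η Y : Vc n) : ℝ :=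
  fderiv ℝ (fun ζ => Q x ξ ζ Y) η (Pi.single i 1)

/-- Partial derivative in the fiber variable `Y`. -/
def pdYv (n : ℕ) (i : Fin (2*n+1)) (Q : Vc n → Vc n → Vc n → Vc n → ℝ)
    (x ξ η Y : Vc n) : ℝ :=
  fderiv ℝ (fun ζ => Q x ξ η ζ) Y (Pi.single i 1)

/-- `Q` belongs to `S^{km}_{ℓ;ν}(ℝ^{2n+1})`: smooth in all variables and homogeneous of
degree `k` in `ξ`, `m` in `η`, `l` in `Y`. -/
def InS (n k m l : ℕ) (Q : Vc n → Vc n → Vc n → Vc n → ℝ) : Prop :=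
  ContDiff ℝ (⊤ : ℕ∞) (fun p : (Vc n × Vc n) × (Vc n × Vc n) => Q p.1.1 p.1.2 p.2.1 p.2.2) ∧
  (∀ x ξ η Y (c : ℝ), Q x (c • ξ) η Y = c ^ k * Q x ξ η Y) ∧
  (∀ x ξ η Y (c : ℝ), Q x ξ (c • η) Y = c ^ m * Q x ξ η Y) ∧
  (∀ x ξ η Y (c : ℝ), Q x ξ η (c • Y) = c ^ l * Q x ξ η Y)

/-- The action of a vector field `Xf` on `S^{km}_{ℓ;ν}`:
`L_X Q = X(Q) − Σ∂_jX^i η_i ∂_{η_j}Q − Σ∂_jX^i ξ_i ∂_{ξ_j}Q + Σ∂_jX^i Y^j ∂_{Y^i}Q + ν(div X)Q`. -/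
def LAct3 (n : ℕ) (ν : ℝ) (Xf : Vc n → Vc n) (Q : Vc n → Vc n → Vc n → Vc n → ℝ)
    (x ξ η Y : Vc n) : ℝ :=
  (∑ i, Xf x i * pdX n i Q x ξ η Y)
  - (∑ i, ∑ j, pd j (fun y => Xf y i) x * η i * pdEta n j Q x ξ η Y)
  - (∑ i, ∑ j, pd j (fun y => Xf y i) x * ξ i * pdXi n j Q x ξ η Y)
  + (∑ i, ∑ j, pd j (fun y => Xf y i) x * Y j * pdYv n i Q x ξ η Y)
  + ν * (∑ i, pd i (fun y => Xf y i) x) * Q x ξ η Y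

/-- `u_1 = ⟨Y,ξ⟩`. -/
def u1 (n : ℕ) (x ξ η Y : Vc n) : ℝ := ∑ i, Y i * ξ i
/-- `u_2 = ⟨Y,η⟩`. -/
def u2 (n : ℕ) (x ξ η Y : Vc n) : ℝ := ∑ i, Y i * η i
/-- `u_3 = α(Y)`. -/
def u3 (n : ℕ) (x ξ η Y : Vc n) : ℝ :=
  (1/2) * ((∑ k : Fin n, (x (pIdx n k) * Y (qIdx n k) - x (qIdx n k) * Y (pIdx n k)))
    - Y (tIdx n))
/-- `u_4 = −2ξ_t`. -/
def u4 (n : ℕ) (x ξ η Y : Vc n) : ℝ := -2 * ξ (tIdx n)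
/-- `u_5 = −2η_t`. -/
def u5 (n : ℕ) (x ξ η Y : Vc n) : ℝ := -2 * η (tIdx n)
/-- `L_1 = Σ_k (ξ_{p_k}η_{q^k} − ξ_{q^k}η_{p_k}) + η_t⟨ℰ_s,ξ_s⟩ − ξ_t⟨ℰ_s,η_s⟩`. -/
def L1p (n : ℕ) (x ξ η Y : Vc n) : ℝ :=
  (∑ k : Fin n, (ξ (pIdx n k) * η (qIdx n k) - ξ (qIdx n k) * η (pIdx n k)))
  + η (tIdx n) * (∑ k : Fin n, (x (pIdx n k) * ξ (pIdx n k) + x (qIdx n k) * ξ (qIdx n k)))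
  - ξ (tIdx n) * (∑ k : Fin n, (x (pIdx n k) * η (pIdx n k) + x (qIdx n k) * η (qIdx n k)))

theorem sum_coord (n : ℕ) (f : Fin (2 * n + 1) → ℝ) :
    ∑ i, f i = (∑ k, f (pIdx n k) + ∑ k, f (qIdx n k)) + f (tIdx n) := by
  rw [Fin.sum_univ_castSucc]
  congr 1
  have e : 2 * n = n + n := by omega
  rw [← (finCongr e.symm).sum_comp, Fin.sum_univ_add]
  rfl

theorem coord_cases {n : ℕ} {P : Fin (2 * n + 1) → Prop} (hp : ∀ k, P (pIdx n k))
    (hq : ∀ k, P (qIdx n k)) (ht : P (tIdx n)) (i : Fin (2 * n + 1)) : P i := by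
  rcases lt_or_ge i.1 n with h | h
  · exact hp ⟨i, h⟩
  · rcases lt_or_ge i.1 (2 * n) with h' | h'
    · have : i = qIdx n ⟨i - n, by omega⟩ := Fin.ext (by simp [qIdx]; omega)
      exact this ▸ hq _
    · have : i = tIdx n := Fin.ext (by simp [tIdx]; omega)
      exact this ▸ ht

/-- The vector with prescribed `p`-, `q`- and `t`-coordinates. -/
def vec {n : ℕ} (a b : Fin n → ℝ) (c : ℝ) : Vc n := fun i =>
  if h : i.1 < n then a ⟨i, h⟩ else if h' : i.1 < 2 * n then b ⟨i - n, by omega⟩ else c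

@[simp] theorem vec_p {n : ℕ} (a b : Fin n → ℝ) (c : ℝ) (k : Fin n) :
    vec a b c (pIdx n k) = a k := by
  simp [vec, pIdx]

@[simp] theorem vec_q {n : ℕ} (a b : Fin n → ℝ) (c : ℝ) (k : Fin n) :
    vec a b c (qIdx n k) = b k := by
  have h : n + k.1 < 2 * n := by omega
  simp [vec, qIdx, h]

@[simp] theorem vec_t {n : ℕ} (a b : Fin n → ℝ) (c : ℝ) : vec a b c (tIdx n) = c := by
  have h : ¬ 2 * n < n := by omega
  simp [vec, tIdx, h]

@[simp] theorem pIdx_ne_tIdx (n : ℕ) (k : Fin n) : pIdx n k ≠ tIdx n := by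
  simp [pIdx, tIdx, Fin.ext_iff]; omega

@[simp] theorem qIdx_ne_tIdx (n : ℕ) (k : Fin n) : qIdx n k ≠ tIdx n := by
  simp [qIdx, tIdx, Fin.ext_iff]; omega

theorem contactHam_p (n : ℕ) (h : Vc n → ℝ) (x : Vc n) (k : Fin n) :
    contactHam n h x (pIdx n k) = -pd (qIdx n k) h x - pd (tIdx n) h x * x (pIdx n k) := by
  simp [contactHam, pIdx]

theorem contactHam_q (n : ℕ) (h : Vc n → ℝ) (x : Vc n) (k : Fin n) :
    contactHam n h x (qIdx n k) = pd (pIdx n k) h x - pd (tIdx n) h x * x (qIdx n k) := by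
  have h : n + k.1 < 2 * n := by omega
  simp [contactHam, qIdx, h]

theorem contactHam_t (n : ℕ) (h : Vc n → ℝ) (x : Vc n) :
    contactHam n h x (tIdx n) = (∑ k : Fin n, (x (pIdx n k) * pd (pIdx n k) h x
      + x (qIdx n k) * pd (qIdx n k) h x)) - 2 * h x := by
  have h : ¬ 2 * n < n := by omega
  simp [contactHam, tIdx, h]

section Partials

variable {ι : Type*} [Fintype ι] [DecidableEq ι]

theorem sum_mul_pd (f : (ι → ℝ) → ℝ) (x v : ι → ℝ) :
    ∑ i, v i * pd i f x = fderiv ℝ f x v := by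
  conv_rhs => rw [pi_eq_sum_univ' v, map_sum]
  simp [pd]

theorem contDiff_pd {f : (ι → ℝ) → ℝ} (hf : ContDiff ℝ (⊤ : ℕ∞) f) (i : ι) :
    ContDiff ℝ (⊤ : ℕ∞) (pd i f) :=
  (hf.fderiv_right (m := (⊤ : ℕ∞)) (by simp)).clm_apply contDiff_const

theorem pd_comm {f : (ι → ℝ) → ℝ} (hf : ContDiff ℝ (⊤ : ℕ∞) f) (i j : ι) (x : ι → ℝ) :
    pd i (pd j f) x = pd j (pd i f) x := by
  have hd : DifferentiableAt ℝ (fderiv ℝ f) x :=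
    ((hf.fderiv_right (m := (⊤ : ℕ∞)) (by simp)).differentiable (by simp)) x
  have key : ∀ a b : ι, pd a (pd b f) x
      = fderiv ℝ (fderiv ℝ f) x (Pi.single a 1) (Pi.single b 1) := by
    intro a b
    have := (hd.hasFDerivAt.clm_apply (hasFDerivAt_const (Pi.single b (1 : ℝ)) x)).fderiv
    unfold pd
    rw [this]
    simp
  rw [key, key]
  exact (hf.contDiffAt.isSymmSndFDerivAt
    (by simpa using WithTop.coe_le_coe.2 (le_top (a := (2 : ℕ∞))))) _ _

end Partials

section Jacobian

variable {n : ℕ} {h : Vc n → ℝ}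

theorem fderiv_contactHam_p (hh : ContDiff ℝ (⊤ : ℕ∞) h) (x v : Vc n) (k : Fin n) :
    fderiv ℝ (fun y => contactHam n h y (pIdx n k)) x v
      = -fderiv ℝ (pd (qIdx n k) h) x v - fderiv ℝ (pd (tIdx n) h) x v * x (pIdx n k)
        - pd (tIdx n) h x * v (pIdx n k) := by
  have d : ∀ a, HasFDerivAt (pd a h) (fderiv ℝ (pd a h) x) x := fun a =>
    ((contDiff_pd hh a).differentiable (by simp) x).hasFDerivAt
  simp_rw [contactHam_p]
  rw [((d _).fun_neg.fun_sub ((d _).fun_mul (hasFDerivAt_apply (𝕜 := ℝ) (pIdx n k) x))).fderiv]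
  simp
  ring

theorem fderiv_contactHam_q (hh : ContDiff ℝ (⊤ : ℕ∞) h) (x v : Vc n) (k : Fin n) :
    fderiv ℝ (fun y => contactHam n h y (qIdx n k)) x v
      = fderiv ℝ (pd (pIdx n k) h) x v - fderiv ℝ (pd (tIdx n) h) x v * x (qIdx n k)
        - pd (tIdx n) h x * v (qIdx n k) := by
  have d : ∀ a, HasFDerivAt (pd a h) (fderiv ℝ (pd a h) x) x := fun a =>
    ((contDiff_pd hh a).differentiable (by simp) x).hasFDerivAt
  simp_rw [contactHam_q]
  rw [((d _).fun_sub ((d _).fun_mul (hasFDerivAt_apply (𝕜 := ℝ) (qIdx n k) x))).fderiv]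
  simp
  ring

theorem fderiv_contactHam_t (hh : ContDiff ℝ (⊤ : ℕ∞) h) (x v : Vc n) :
    fderiv ℝ (fun y => contactHam n h y (tIdx n)) x v
      = (∑ k : Fin n, (v (pIdx n k) * pd (pIdx n k) h x
          + x (pIdx n k) * fderiv ℝ (pd (pIdx n k) h) x v
          + v (qIdx n k) * pd (qIdx n k) h x
          + x (qIdx n k) * fderiv ℝ (pd (qIdx n k) h) x v)) - 2 * fderiv ℝ h x v := by
  have d : ∀ a, HasFDerivAt (pd a h) (fderiv ℝ (pd a h) x) x := fun a =>
    ((contDiff_pd hh a).differentiable (by simp) x).hasFDerivAt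
  have dh : HasFDerivAt h (fderiv ℝ h x) x := (hh.differentiable (by simp) x).hasFDerivAt
  simp_rw [contactHam_t]
  rw [((HasFDerivAt.fun_sum (u := Finset.univ) fun k _ =>
    ((hasFDerivAt_apply (𝕜 := ℝ) (pIdx n k) x).fun_mul (d (pIdx n k))).fun_add
    ((hasFDerivAt_apply (𝕜 := ℝ) (qIdx n k) x).fun_mul (d (qIdx n k)))).fun_sub
      (dh.const_mul 2)).fderiv]
  simp only [sub_apply, sum_apply,
    add_apply, smul_apply,
    ContinuousLinearMap.proj_apply, smul_eq_mul]
  congr 1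
  exact Finset.sum_congr rfl fun k _ => by ring

end Jacobian

/-- The Lie derivative of a covector `ξ`, up to sign: `-⟨∂X, ξ⟩`. -/
def covectorVel {n : ℕ} (X : Vc n → Vc n) (x ξ : Vc n) : Vc n := fun j =>
  -∑ i, pd j (fun y => X y i) x * ξ i

/-- The directional derivative `∂X · Y` of the vector field `X`. -/
def vectorVel {n : ℕ} (X : Vc n → Vc n) (x Y : Vc n) : Vc n := fun i =>
  ∑ j, pd j (fun y => X y i) x * Y j

/-- The divergence of a vector field. -/
def divergence {n : ℕ} (X : Vc n → Vc n) (x : Vc n) : ℝ := ∑ i, pd i (fun y => X y i) x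

/-- The total space of the fiber variables over the base. -/
abbrev Tot (n : ℕ) : Type := (Vc n × Vc n) × (Vc n × Vc n)

/-- The function of one variable in the total space associated with `Q`. -/
def unc {n : ℕ} (Q : Vc n → Vc n → Vc n → Vc n → ℝ) (p : Tot n) : ℝ := Q p.1.1 p.1.2 p.2.1 p.2.2

/-- The lift of a vector field to the total space. -/
def lift {n : ℕ} (X : Vc n → Vc n) (p : Tot n) : Tot n :=
  ((X p.1.1, covectorVel X p.1.1 p.1.2), (covectorVel X p.1.1 p.2.1, vectorVel X p.1.1 p.2.2))

section Lift

variable {n : ℕ} {Q : Vc n → Vc n → Vc n → Vc n → ℝ}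

theorem fderiv_unc (hQ : Differentiable ℝ (unc Q)) (p v : Tot n) :
    fderiv ℝ (unc Q) p v
      = ∑ i, v.1.1 i * pdX n i Q p.1.1 p.1.2 p.2.1 p.2.2
        + ∑ i, v.1.2 i * pdXi n i Q p.1.1 p.1.2 p.2.1 p.2.2
        + ∑ i, v.2.1 i * pdEta n i Q p.1.1 p.1.2 p.2.1 p.2.2
        + ∑ i, v.2.2 i * pdYv n i Q p.1.1 p.1.2 p.2.1 p.2.2 := by
  obtain ⟨⟨x, ξ⟩, ⟨η, Y⟩⟩ := p
  obtain ⟨⟨v₁, v₂⟩, ⟨v₃, v₄⟩⟩ := v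
  have hD := (hQ ((x, ξ), (η, Y))).hasFDerivAt
  have e₁ := sum_mul_pd (fun y => Q y ξ η Y) x v₁
  have e₂ := sum_mul_pd (fun y => Q x y η Y) ξ v₂
  have e₃ := sum_mul_pd (fun y => Q x ξ y Y) η v₃
  have e₄ := sum_mul_pd (fun y => Q x ξ η y) Y v₄
  have i₁ : HasFDerivAt (fun y : Vc n => (((y, ξ), (η, Y)) : Tot n)) _ x :=
    ((hasFDerivAt_id (𝕜 := ℝ) x).prodMk (hasFDerivAt_const ξ x)).prodMk
      (hasFDerivAt_const (η, Y) x)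
  have i₂ : HasFDerivAt (fun y : Vc n => (((x, y), (η, Y)) : Tot n)) _ ξ :=
    ((hasFDerivAt_const x ξ).prodMk (hasFDerivAt_id (𝕜 := ℝ) ξ)).prodMk
      (hasFDerivAt_const (η, Y) ξ)
  have i₃ : HasFDerivAt (fun y : Vc n => (((x, ξ), (y, Y)) : Tot n)) _ η :=
    (hasFDerivAt_const (x, ξ) η).prodMk
      ((hasFDerivAt_id (𝕜 := ℝ) η).prodMk (hasFDerivAt_const Y η))
  have i₄ : HasFDerivAt (fun y : Vc n => (((x, ξ), (η, y)) : Tot n)) _ Y :=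
    (hasFDerivAt_const (x, ξ) Y).prodMk
      ((hasFDerivAt_const η Y).prodMk (hasFDerivAt_id (𝕜 := ℝ) Y))
  have f₁ : fderiv ℝ (fun y => Q y ξ η Y) x v₁ = fderiv ℝ (unc Q) ((x, ξ), (η, Y)) ((v₁, 0), 0) :=
    congrArg (fun L => L v₁) (HasFDerivAt.comp x hD i₁).fderiv
  have f₂ : fderiv ℝ (fun y => Q x y η Y) ξ v₂ = fderiv ℝ (unc Q) ((x, ξ), (η, Y)) ((0, v₂), 0) :=
    congrArg (fun L => L v₂) (HasFDerivAt.comp ξ hD i₂).fderiv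
  have f₃ : fderiv ℝ (fun y => Q x ξ y Y) η v₃ = fderiv ℝ (unc Q) ((x, ξ), (η, Y)) (0, (v₃, 0)) :=
    congrArg (fun L => L v₃) (HasFDerivAt.comp η hD i₃).fderiv
  have f₄ : fderiv ℝ (fun y => Q x ξ η y) Y v₄ = fderiv ℝ (unc Q) ((x, ξ), (η, Y)) (0, (0, v₄)) :=
    congrArg (fun L => L v₄) (HasFDerivAt.comp Y hD i₄).fderiv
  have split : (((v₁, v₂), (v₃, v₄)) : Tot n)
      = ((v₁, 0), 0) + ((0, v₂), 0) + (0, (v₃, 0)) + (0, (0, v₄)) := by simp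
  simp only [pd] at e₁ e₂ e₃ e₄
  simp only [pdX, pdXi, pdEta, pdYv]
  rw [e₁, e₂, e₃, e₄, f₁, f₂, f₃, f₄, split]
  simp only [map_add]

theorem LAct3_eq (hQ : Differentiable ℝ (unc Q)) (ν : ℝ) (X : Vc n → Vc n) (x ξ η Y : Vc n) :
    LAct3 n ν X Q x ξ η Y
      = fderiv ℝ (unc Q) ((x, ξ), (η, Y)) (lift X ((x, ξ), (η, Y)))
        + ν * divergence X x * Q x ξ η Y := by
  rw [fderiv_unc hQ]
  simp only [LAct3, lift, divergence, covectorVel, vectorVel, neg_mul, Finset.sum_neg_distrib,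
    Finset.sum_mul]
  rw [Finset.sum_comm (f := fun i j => pd j (fun y => X y i) x * η i * _),
    Finset.sum_comm (f := fun i j => pd j (fun y => X y i) x * ξ i * _)]
  ring

/-- `Q` changes along integral curves of the lift of `X` only through the divergence. -/
theorem hasDerivAt_unc_comp (hQ : Differentiable ℝ (unc Q)) {ν : ℝ} {X : Vc n → Vc n}
    (hX : ∀ x ξ η Y, LAct3 n ν X Q x ξ η Y = 0) {γ : ℝ → Tot n} {s : ℝ}
    (hγ : HasDerivAt γ (lift X (γ s)) s) :
    HasDerivAt (fun r => unc Q (γ r)) (-(ν * divergence X (γ s).1.1 * unc Q (γ s))) s := by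
  have h := hX (γ s).1.1 (γ s).1.2 (γ s).2.1 (γ s).2.2
  rw [LAct3_eq hQ] at h
  refine ((hQ (γ s)).hasFDerivAt.comp_hasDerivAt s hγ).congr_deriv ?_
  change fderiv ℝ (unc Q) (γ s) (lift X (γ s)) + ν * divergence X (γ s).1.1 * unc Q (γ s) = 0 at h
  linarith

/-- If `X` is divergence-free along an integral curve `p + s • v` of its lift, `Q` is constant
along it. -/
theorem unc_eq_of_affine (hQ : Differentiable ℝ (unc Q)) {ν : ℝ} {X : Vc n → Vc n}
    (hX : ∀ x ξ η Y, LAct3 n ν X Q x ξ η Y = 0) {p v : Tot n}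
    (hv : ∀ s : ℝ, lift X (p + s • v) = v) (hdiv : ∀ s : ℝ, divergence X (p + s • v).1.1 = 0)
    (s : ℝ) : unc Q (p + s • v) = unc Q p := by
  have hd : ∀ s : ℝ, HasDerivAt (fun r : ℝ => unc Q (p + r • v)) 0 s := by
    intro s
    have hγ : HasDerivAt (fun r : ℝ => p + r • v) (lift X (p + s • v)) s := by
      rw [hv]
      simpa using ((hasDerivAt_id s).smul_const v).const_add p
    have := hasDerivAt_unc_comp hQ hX hγ
    rwa [hdiv, mul_zero, zero_mul, neg_zero] at this
  have := is_const_of_deriv_eq_zero (fun s => (hd s).differentiableAt) (fun s => (hd s).deriv) s 0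
  simpa using this

end Lift

/-- The coefficients through which the second derivatives of `h` act on the covector `ξ`. -/
def twist {n : ℕ} (x ξ : Vc n) : Vc n :=
  vec (fun k => ξ (qIdx n k) + x (pIdx n k) * ξ (tIdx n))
    (fun k => x (qIdx n k) * ξ (tIdx n) - ξ (pIdx n k))
    (-∑ k, (x (pIdx n k) * ξ (pIdx n k) + x (qIdx n k) * ξ (qIdx n k)))

section ContactLift

variable {n : ℕ} {h : Vc n → ℝ}

theorem covectorVel_contactHam (hh : ContDiff ℝ (⊤ : ℕ∞) h) (x ξ : Vc n) (j : Fin (2 * n + 1)) :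
    covectorVel (contactHam n h) x ξ j
      = -∑ a, pd j (pd a h) x * twist x ξ a + pd (tIdx n) h x * ξ j
        + pd j h x * ξ (tIdx n) := by
  have e : ξ j = ∑ i, (Pi.single j (1 : ℝ) : Vc n) i * ξ i := by simp [Pi.single_apply]
  have e' : pd j h x = ∑ i, (Pi.single j (1 : ℝ) : Vc n) i * pd i h x := by
    simp [Pi.single_apply]
  simp only [covectorVel, sum_coord]
  simp only [pd, fderiv_contactHam_p hh, fderiv_contactHam_q hh, fderiv_contactHam_t hh, twist,
    vec_p, vec_q, vec_t]
  simp only [← pd.eq_1]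
  rw [sum_coord] at e e'
  generalize (Pi.single j (1 : ℝ) : Vc n) = v at *
  rw [e, e']
  simp only [two_mul, mul_add, add_mul, mul_sub, sub_mul, neg_mul, mul_neg, Finset.sum_add_distrib,
    Finset.sum_sub_distrib, Finset.sum_neg_distrib, Finset.sum_mul, Finset.mul_sum]
  simp only [mul_assoc, mul_comm, mul_left_comm]
  linarith

theorem vectorVel_apply {X : Vc n → Vc n} (x Y : Vc n) (i : Fin (2 * n + 1)) :
    vectorVel X x Y i = fderiv ℝ (fun y => X y i) x Y := by
  rw [← sum_mul_pd]
  exact Finset.sum_congr rfl fun j _ => mul_comm _ _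

theorem divergence_contactHam (hh : ContDiff ℝ (⊤ : ℕ∞) h) (x : Vc n) :
    divergence (contactHam n h) x = -(2 * n + 2) * pd (tIdx n) h x := by
  have c := fun k => pd_comm hh (pIdx n k) (qIdx n k) x
  have ct := fun k => pd_comm hh (tIdx n) k x
  have hpt : ∀ k, (Pi.single (tIdx n) (1 : ℝ) : Vc n) (pIdx n k) = 0 := fun k => by simp
  have hqt : ∀ k, (Pi.single (tIdx n) (1 : ℝ) : Vc n) (qIdx n k) = 0 := fun k => by simp
  simp only [divergence, sum_coord]
  simp only [pd, fderiv_contactHam_p hh, fderiv_contactHam_q hh, fderiv_contactHam_t hh, hpt, hqt,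
    Pi.single_eq_same]
  simp only [← pd.eq_1, c, ct]
  simp only [add_mul, neg_mul, Finset.sum_add_distrib, Finset.sum_sub_distrib,
    Finset.sum_neg_distrib, Finset.sum_const]
  simp only [mul_comm, mul_zero, mul_one, Finset.sum_const_zero, Finset.card_univ,
    Fintype.card_fin, nsmul_eq_mul]
  linarith

theorem sum_hessian_twist_comm (hh : ContDiff ℝ (⊤ : ℕ∞) h) (x ξ η : Vc n) :
    ∑ j, (∑ a, pd j (pd a h) x * twist x ξ a) * twist x η j
      = ∑ j, (∑ a, pd j (pd a h) x * twist x η a) * twist x ξ j := by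
  simp only [Finset.sum_mul]
  rw [Finset.sum_comm]
  refine Finset.sum_congr rfl fun i _ => Finset.sum_congr rfl fun j _ => ?_
  rw [pd_comm hh i j]
  ring

variable {x ξ η Y : ℝ → Vc n} {s : ℝ}

theorem hasDerivAt_pairing {X : Vc n → Vc n} {ζ : ℝ → Vc n}
    (hζ : HasDerivAt ζ (covectorVel X (x s) (ζ s)) s)
    (hY : HasDerivAt Y (vectorVel X (x s) (Y s)) s) :
    HasDerivAt (fun r => ∑ i, Y r i * ζ r i) 0 s := by
  rw [hasDerivAt_pi] at hζ hY
  refine (HasDerivAt.fun_sum fun i _ => (hY i).fun_mul (hζ i)).congr_deriv ?_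
  simp only [Finset.sum_add_distrib, covectorVel, vectorVel, mul_neg, Finset.sum_neg_distrib,
    Finset.sum_mul, Finset.mul_sum]
  rw [Finset.sum_comm, add_neg_eq_zero]
  exact Finset.sum_congr rfl fun i _ => Finset.sum_congr rfl fun j _ => by ring

theorem hasDerivAt_u3 (hh : ContDiff ℝ (⊤ : ℕ∞) h)
    (hx : HasDerivAt x (contactHam n h (x s)) s)
    (hY : HasDerivAt Y (vectorVel (contactHam n h) (x s) (Y s)) s) :
    HasDerivAt (fun r => u3 n (x r) (ξ r) (η r) (Y r))
      (-2 * pd (tIdx n) h (x s) * u3 n (x s) (ξ s) (η s) (Y s)) s := by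
  rw [hasDerivAt_pi] at hx hY
  refine (((HasDerivAt.fun_sum (u := Finset.univ) fun k _ =>
    ((hx (pIdx n k)).fun_mul (hY (qIdx n k))).fun_sub
      ((hx (qIdx n k)).fun_mul (hY (pIdx n k)))).fun_sub
    (hY (tIdx n))).const_mul (1 / 2)).congr_deriv ?_
  have key : ∀ A B c : ℝ, A = -2 * c * B → 1 / 2 * A = -2 * c * (1 / 2 * B) := by
    intro A B c hAB
    rw [hAB]
    ring
  refine key _ _ _ ?_
  simp only [vectorVel_apply, fderiv_contactHam_p hh, fderiv_contactHam_q hh,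
    fderiv_contactHam_t hh]
  rw [← sum_mul_pd h (x s) (Y s), sum_coord]
  simp only [contactHam_p, contactHam_q, two_mul, neg_add, mul_add, add_mul, mul_sub, sub_mul,
    neg_mul, mul_neg, Finset.sum_add_distrib, Finset.sum_sub_distrib, Finset.sum_neg_distrib,
    Finset.mul_sum]
  simp only [mul_assoc, mul_comm, mul_left_comm]
  linarith

theorem hasDerivAt_L1p (hh : ContDiff ℝ (⊤ : ℕ∞) h)
    (hx : HasDerivAt x (contactHam n h (x s)) s)
    (hξ : HasDerivAt ξ (covectorVel (contactHam n h) (x s) (ξ s)) s)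
    (hη : HasDerivAt η (covectorVel (contactHam n h) (x s) (η s)) s) :
    HasDerivAt (fun r => L1p n (x r) (ξ r) (η r) (Y r))
      (2 * pd (tIdx n) h (x s) * L1p n (x s) (ξ s) (η s) (Y s)) s := by
  have sym := sum_hessian_twist_comm hh (x s) (ξ s) (η s)
  rw [hasDerivAt_pi] at hx hξ hη
  have euler : ∀ {ζ : ℝ → Vc n} {v : Vc n}, (∀ i, HasDerivAt (fun r => ζ r i) (v i) s) → _ :=
    fun {ζ v} hζ => HasDerivAt.fun_sum (u := Finset.univ) fun k _ =>
      ((hx (pIdx n k)).fun_mul (hζ (pIdx n k))).fun_add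
        ((hx (qIdx n k)).fun_mul (hζ (qIdx n k)))
  refine (((HasDerivAt.fun_sum (u := Finset.univ) fun k _ =>
    ((hξ (pIdx n k)).fun_mul (hη (qIdx n k))).fun_sub
      ((hξ (qIdx n k)).fun_mul (hη (pIdx n k)))).fun_add
    ((hη (tIdx n)).fun_mul (euler hξ))).fun_sub
    ((hξ (tIdx n)).fun_mul (euler hη))).congr_deriv ?_
  simp only [covectorVel_contactHam hh, contactHam_p, contactHam_q, L1p]
  generalize hK : (fun j => ∑ a, pd j (pd a h) (x s) * twist (x s) (ξ s) a) = K at sym ⊢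
  generalize hM : (fun j => ∑ a, pd j (pd a h) (x s) * twist (x s) (η s) a) = M at sym ⊢
  have hK' := fun j => congrFun hK j
  have hM' := fun j => congrFun hM j
  simp only [hK', hM'] at sym ⊢
  rw [sum_coord, sum_coord] at sym
  simp only [twist, vec_p, vec_q, vec_t] at sym
  simp only [two_mul, neg_add, mul_add, add_mul, mul_sub, sub_mul, neg_mul, mul_neg,
    Finset.sum_add_distrib, Finset.sum_sub_distrib, Finset.sum_neg_distrib,
    Finset.mul_sum] at sym ⊢
  simp only [mul_assoc, mul_comm, mul_left_comm] at sym ⊢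
  linarith

end ContactLift

theorem hasDerivAt_monomial {u v w z : ℝ → ℝ} {s δ : ℝ} (hu : HasDerivAt u 0 s)
    (hv : HasDerivAt v 0 s) (hw : HasDerivAt w (-δ * w s) s) (hz : HasDerivAt z (δ * z s) s)
    (e : ℝ) (a b c f : ℕ) :
    HasDerivAt (fun r => e * u r ^ a * v r ^ b * w r ^ c * z r ^ f)
      (δ * (f - c) * (e * u s ^ a * v s ^ b * w s ^ c * z s ^ f)) s := by
  have hpow : ∀ (y d : ℝ) (r : ℕ), r * y ^ (r - 1) * (d * y) = r * d * y ^ r := by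
    intro y d r
    cases r with
    | zero => simp
    | succ r => simp; ring
  refine (((((hu.fun_pow a).const_mul e).fun_mul (hv.fun_pow b)).fun_mul
    (hw.fun_pow c)).fun_mul (hz.fun_pow f)).congr_deriv ?_
  rw [hpow, hpow]
  ring

theorem invariant_of_eq_sum {n k m l : ℕ} {ν : ℝ} {Q : Vc n → Vc n → Vc n → Vc n → ℝ}
    (hQ : Differentiable ℝ (unc Q)) {co : ℕ → ℕ → ℕ → ℕ → ℝ}
    (hco : ∀ a b c f : ℕ, co a b c f ≠ 0 → (f : ℝ) - c = (n + 1) * ν)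
    (hsum : ∀ x ξ η Y, Q x ξ η Y =
      ∑ a ∈ Finset.range (k + 1), ∑ b ∈ Finset.range (m + 1), ∑ c ∈ Finset.range (l + 1),
        ∑ f ∈ Finset.range (k + 1), co a b c f * u1 n x ξ η Y ^ a * u2 n x ξ η Y ^ b
          * u3 n x ξ η Y ^ c * L1p n x ξ η Y ^ f)
    {h : Vc n → ℝ} (hh : ContDiff ℝ (⊤ : ℕ∞) h) (x ξ η Y : Vc n) :
    LAct3 n ν (contactHam n h) Q x ξ η Y = 0 := by
  set X := contactHam n h with hX
  set p : Tot n := ((x, ξ), (η, Y)) with hp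
  set γ : ℝ → Tot n := fun s => p + s • lift X p with hγ
  have hγ0 : γ 0 = p := by simp [hγ]
  have dγ : HasDerivAt γ (lift X p) 0 := by
    have := ((hasDerivAt_id (0 : ℝ)).smul_const (lift X p)).const_add p
    rwa [one_smul] at this
  have dx : HasDerivAt (fun s => (γ s).1.1) (contactHam n h (γ 0).1.1) 0 := by
    rw [hγ0]; exact dγ.fst.fst
  have dξ : HasDerivAt (fun s => (γ s).1.2) (covectorVel X (γ 0).1.1 (γ 0).1.2) 0 := by
    rw [hγ0]; exact dγ.fst.snd
  have dη : HasDerivAt (fun s => (γ s).2.1) (covectorVel X (γ 0).1.1 (γ 0).2.1) 0 := by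
    rw [hγ0]; exact dγ.snd.fst
  have dY : HasDerivAt (fun s => (γ s).2.2) (vectorVel X (γ 0).1.1 (γ 0).2.2) 0 := by
    rw [hγ0]; exact dγ.snd.snd
  have d₁ : HasDerivAt (fun s => u1 n (γ s).1.1 (γ s).1.2 (γ s).2.1 (γ s).2.2) 0 0 :=
    hasDerivAt_pairing (x := fun s => (γ s).1.1) dξ dY
  have d₂ : HasDerivAt (fun s => u2 n (γ s).1.1 (γ s).1.2 (γ s).2.1 (γ s).2.2) 0 0 :=
    hasDerivAt_pairing (x := fun s => (γ s).1.1) dη dY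
  have d₃ := hasDerivAt_u3 (x := fun s => (γ s).1.1) (ξ := fun s => (γ s).1.2)
    (η := fun s => (γ s).2.1) (Y := fun s => (γ s).2.2) hh dx dY
  have d₄ := hasDerivAt_L1p (x := fun s => (γ s).1.1) (ξ := fun s => (γ s).1.2)
    (η := fun s => (γ s).2.1) (Y := fun s => (γ s).2.2) hh dx dξ dη
  rw [neg_mul (2 : ℝ)] at d₃
  have dQ : HasDerivAt (fun s => unc Q (γ s)) (fderiv ℝ (unc Q) (γ 0) (lift X p)) 0 :=
    (hQ (γ 0)).hasFDerivAt.comp_hasDerivAt 0 dγ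
  have dQ' : HasDerivAt (fun s => unc Q (γ s))
      (2 * pd (tIdx n) h (γ 0).1.1 * ((n + 1) * ν) * unc Q (γ 0)) 0 := by
    simp only [unc, hsum, Finset.mul_sum]
    refine HasDerivAt.fun_sum fun a _ => HasDerivAt.fun_sum fun b _ => HasDerivAt.fun_sum fun c _ =>
      HasDerivAt.fun_sum fun f _ => ?_
    refine (hasDerivAt_monomial d₁ d₂ d₃ d₄ (co a b c f) a b c f).congr_deriv ?_
    by_cases h0 : co a b c f = 0
    · simp only [h0, zero_mul, mul_zero]
    · rw [hco a b c f h0]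
  have e := dQ.unique dQ'
  rw [hγ0] at e
  rw [LAct3_eq hQ, divergence_contactHam hh, e]
  simp only [unc, hp]
  ring

/-- The quadratic function with constant term `c`, linear part `b` and quadratic part `w ⊗ v`. -/
def quad {n : ℕ} (c : ℝ) (b w v : Vc n) (y : Vc n) : ℝ := c + y ⬝ᵥ b + (y ⬝ᵥ w) * (y ⬝ᵥ v)

section Quad

variable {n : ℕ} (c : ℝ) (b w v : Vc n)

theorem contDiff_quad : ContDiff ℝ (⊤ : ℕ∞) (quad c b w v) := by
  unfold quad dotProduct
  fun_prop

theorem hasFDerivAt_dotProduct (x : Vc n) :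
    HasFDerivAt (fun y : Vc n => y ⬝ᵥ b)
      (∑ i, b i • ContinuousLinearMap.proj (R := ℝ) (φ := fun _ => ℝ) i) x := by
  unfold dotProduct
  exact HasFDerivAt.fun_sum fun i _ => (hasFDerivAt_apply (𝕜 := ℝ) i x).mul_const (b i)

theorem fderiv_quad (x y : Vc n) :
    fderiv ℝ (quad c b w v) x y = y ⬝ᵥ b + (x ⬝ᵥ w) * (y ⬝ᵥ v) + (x ⬝ᵥ v) * (y ⬝ᵥ w) := by
  have key : ∀ b : Vc n, (∑ i, b i • ContinuousLinearMap.proj (R := ℝ) (φ := fun _ => ℝ) i) y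
      = y ⬝ᵥ b := by
    intro b
    simp [dotProduct, mul_comm]
  have := (((hasFDerivAt_dotProduct b x).const_add c).fun_add
    ((hasFDerivAt_dotProduct w x).fun_mul (hasFDerivAt_dotProduct v x))).fderiv
  change fderiv ℝ (fun z : Vc n => c + z ⬝ᵥ b + (z ⬝ᵥ w) * (z ⬝ᵥ v)) x y = _
  rw [this]
  simp only [add_apply, smul_apply, key, smul_eq_mul]
  ring

theorem pd_quad (j : Fin (2 * n + 1)) (x : Vc n) :
    pd j (quad c b w v) x = b j + (x ⬝ᵥ w) * v j + (x ⬝ᵥ v) * w j := by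
  simp [pd, fderiv_quad]

theorem fderiv_pd_quad (j : Fin (2 * n + 1)) (x y : Vc n) :
    fderiv ℝ (pd j (quad c b w v)) x y = (y ⬝ᵥ w) * v j + (y ⬝ᵥ v) * w j := by
  have e : pd j (quad c b w v) = quad (b j) (v j • w + w j • v) 0 0 := by
    funext x
    simp [pd_quad, quad, dotProduct_add, dotProduct_smul]
    ring
  rw [e, fderiv_quad]
  simp [dotProduct_add, dotProduct_smul]
  ring

theorem pd_pd_quad (i j : Fin (2 * n + 1)) (x : Vc n) :
    pd i (pd j (quad c b w v)) x = w i * v j + v i * w j := by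
  simp [pd.eq_1 i, fderiv_pd_quad]

theorem covectorVel_quad (x ξ : Vc n) :
    covectorVel (contactHam n (quad c b w v)) x ξ
      = -(v ⬝ᵥ twist x ξ) • w - (w ⬝ᵥ twist x ξ) • v
        + pd (tIdx n) (quad c b w v) x • ξ
        + ξ (tIdx n) • fun j => pd j (quad c b w v) x := by
  funext j
  rw [covectorVel_contactHam (contDiff_quad c b w v)]
  simp only [pd_pd_quad, dotProduct, Pi.add_apply, Pi.sub_apply, Pi.smul_apply, smul_eq_mul,
    add_mul, Finset.sum_add_distrib, neg_mul, Finset.sum_mul]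
  simp only [mul_comm, mul_left_comm]
  ring

theorem vectorVel_quad_p (x Y : Vc n) (k : Fin n) :
    vectorVel (contactHam n (quad c b w v)) x Y (pIdx n k)
      = -((Y ⬝ᵥ w) * v (qIdx n k) + (Y ⬝ᵥ v) * w (qIdx n k))
        - ((Y ⬝ᵥ w) * v (tIdx n) + (Y ⬝ᵥ v) * w (tIdx n)) * x (pIdx n k)
        - pd (tIdx n) (quad c b w v) x * Y (pIdx n k) := by
  rw [vectorVel_apply, fderiv_contactHam_p (contDiff_quad c b w v), fderiv_pd_quad,
    fderiv_pd_quad]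

theorem vectorVel_quad_q (x Y : Vc n) (k : Fin n) :
    vectorVel (contactHam n (quad c b w v)) x Y (qIdx n k)
      = ((Y ⬝ᵥ w) * v (pIdx n k) + (Y ⬝ᵥ v) * w (pIdx n k))
        - ((Y ⬝ᵥ w) * v (tIdx n) + (Y ⬝ᵥ v) * w (tIdx n)) * x (qIdx n k)
        - pd (tIdx n) (quad c b w v) x * Y (qIdx n k) := by
  rw [vectorVel_apply, fderiv_contactHam_q (contDiff_quad c b w v), fderiv_pd_quad,
    fderiv_pd_quad]

theorem vectorVel_quad_t (x Y : Vc n) :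
    vectorVel (contactHam n (quad c b w v)) x Y (tIdx n)
      = (∑ k : Fin n, (Y (pIdx n k) * pd (pIdx n k) (quad c b w v) x
          + x (pIdx n k) * ((Y ⬝ᵥ w) * v (pIdx n k) + (Y ⬝ᵥ v) * w (pIdx n k))
          + Y (qIdx n k) * pd (qIdx n k) (quad c b w v) x
          + x (qIdx n k) * ((Y ⬝ᵥ w) * v (qIdx n k) + (Y ⬝ᵥ v) * w (qIdx n k))))
        - 2 * fderiv ℝ (quad c b w v) x Y := by
  rw [vectorVel_apply, fderiv_contactHam_t (contDiff_quad c b w v)]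
  simp only [fderiv_pd_quad]

end Quad

theorem dotProduct_coord {n : ℕ} (x y : Vc n) :
    x ⬝ᵥ y = ∑ k, x (pIdx n k) * y (pIdx n k) + ∑ k, x (qIdx n k) * y (qIdx n k)
      + x (tIdx n) * y (tIdx n) :=
  sum_coord n _

section Moves

variable {n : ℕ} {ν : ℝ} {Q : Vc n → Vc n → Vc n → Vc n → ℝ}

theorem translation_invariant (hQ : Differentiable ℝ (unc Q))
    (hinv : ∀ h : Vc n → ℝ, ContDiff ℝ (⊤ : ℕ∞) h →
      ∀ x ξ η Y, LAct3 n ν (contactHam n h) Q x ξ η Y = 0) (x ξ η Y : Vc n) :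
    let g : Vc n := vec (fun k => x (qIdx n k)) (fun k => -x (pIdx n k)) 0
    Q x (ξ + ξ (tIdx n) • g) (η + η (tIdx n) • g) (Y - (Y ⬝ᵥ g) • vec 0 0 1) = Q 0 ξ η Y := by
  intro g
  have hg : g (tIdx n) = 0 := vec_t ..
  have hd := contDiff_quad (-x (tIdx n) / 2) g 0 0
  have hpd : ∀ j y, pd j (quad (-x (tIdx n) / 2) g 0 0) y = g j := by
    intro j y
    simp [pd_quad]
  have hxg : x ⬝ᵥ g = 0 := by
    simp only [dotProduct_coord, g, vec_p, vec_q, vec_t, mul_zero, add_zero, mul_neg,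
      Finset.sum_neg_distrib]
    simp only [mul_comm]
    ring
  have key := unc_eq_of_affine hQ (hinv _ hd) (p := ((0, ξ), (η, Y)))
    (v := ((x, ξ (tIdx n) • g), (η (tIdx n) • g, -(Y ⬝ᵥ g) • vec 0 0 1))) ?_ ?_ 1
  · simpa [unc, sub_eq_add_neg] using key
  · intro s
    have hcov : ∀ ζ : Vc n, covectorVel (contactHam n (quad (-x (tIdx n) / 2) g 0 0)) (s • x)
        (ζ + s • ζ (tIdx n) • g) = ζ (tIdx n) • g := by
      intro ζ
      rw [covectorVel_quad]
      simp only [hpd, hg]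
      simp [hg]
    refine Prod.ext (Prod.ext ?_ ?_) (Prod.ext ?_ ?_)
    · funext i
      simp only [lift, Prod.fst_add, Prod.smul_fst, zero_add]
      refine coord_cases (P := fun i => contactHam n (quad (-x (tIdx n) / 2) g 0 0) (s • x) i = x i)
        (fun k => ?_) (fun k => ?_) ?_ i
      · simp [contactHam_p, hpd, hg, g]
      · simp [contactHam_q, hpd, hg, g]
      · simp only [contactHam_t, hpd, quad, smul_dotProduct, hxg]
        simp [g]
        have : ∀ k, s * x (pIdx n k) * x (qIdx n k) + -(s * x (qIdx n k) * x (pIdx n k)) = 0 :=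
          fun k => by ring
        simp [this]
        ring
    · simpa [lift] using hcov ξ
    · simpa [lift] using hcov η
    · funext i
      simp only [lift, Prod.fst_add, Prod.snd_add, Prod.smul_fst, Prod.smul_snd, zero_add]
      refine coord_cases (P := fun i => vectorVel (contactHam n (quad (-x (tIdx n) / 2) g 0 0))
        (s • x) (Y + s • -(Y ⬝ᵥ g) • vec 0 0 1) i = (-(Y ⬝ᵥ g) • (vec 0 0 1 : Vc n)) i)
        (fun k => ?_) (fun k => ?_) ?_ i
      · simp [vectorVel_quad_p, hpd, hg]
      · simp [vectorVel_quad_q, hpd, hg]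
      · simp [vectorVel_quad_t, hpd, fderiv_quad, add_dotProduct, dotProduct_coord, hg,
          Finset.sum_add_distrib]
        ring
  · intro s
    rw [divergence_contactHam hd, hpd, hg, mul_zero]

theorem shear_invariant (hQ : Differentiable ℝ (unc Q))
    (hinv : ∀ h : Vc n → ℝ, ContDiff ℝ (⊤ : ℕ∞) h →
      ∀ x ξ η Y, LAct3 n ν (contactHam n h) Q x ξ η Y = 0) (a b : Fin n → ℝ) (ξ η Y : Vc n) :
    Q 0 (ξ - (∑ k, (a k * ξ (qIdx n k) - b k * ξ (pIdx n k))) • vec 0 0 1)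
      (η - (∑ k, (a k * η (qIdx n k) - b k * η (pIdx n k))) • vec 0 0 1)
      (Y + Y (tIdx n) • vec (-b) a 0) = Q 0 ξ η Y := by
  set h : Vc n → ℝ := quad 0 0 (vec 0 0 1) (vec a b 0) with hh
  have hd : ContDiff ℝ (⊤ : ℕ∞) h := contDiff_quad ..
  have hpd : ∀ j, pd j h 0 = 0 := by
    intro j
    simp [hh, pd_quad]
  have key := unc_eq_of_affine hQ (hinv _ hd) (p := ((0, ξ), (η, Y)))
    (v := ((0, -(∑ k, (a k * ξ (qIdx n k) - b k * ξ (pIdx n k))) • vec 0 0 1),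
      (-(∑ k, (a k * η (qIdx n k) - b k * η (pIdx n k))) • vec 0 0 1,
        Y (tIdx n) • vec (-b) a 0))) ?_ ?_ 1
  · simpa [unc, sub_eq_add_neg] using key
  · intro s
    have hcov : ∀ (ζ : Vc n) (r : ℝ), covectorVel (contactHam n h) 0 (ζ + r • vec 0 0 1)
        = -(∑ k, (a k * ζ (qIdx n k) - b k * ζ (pIdx n k))) • vec 0 0 1 := by
      intro ζ r
      rw [hh, covectorVel_quad, ← hh]
      simp only [hpd]
      simp [dotProduct_coord, twist, sub_eq_add_neg, Finset.sum_add_distrib]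
      exact Or.inr rfl
    refine Prod.ext (Prod.ext ?_ ?_) (Prod.ext ?_ ?_)
    · funext i
      simp only [lift, Prod.fst_add, Prod.smul_fst, zero_add, smul_zero]
      refine coord_cases (P := fun i => contactHam n h 0 i = (0 : Vc n) i)
        (fun k => ?_) (fun k => ?_) ?_ i
      · simp [contactHam_p, hpd]
      · simp [contactHam_q, hpd]
      · simp [contactHam_t, hh, quad]
    · simpa [lift, smul_smul] using hcov ξ _
    · simpa [lift, smul_smul] using hcov η _
    · funext i
      simp only [lift, Prod.fst_add, Prod.snd_add, Prod.smul_fst, Prod.smul_snd, zero_add,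
        smul_zero]
      refine coord_cases (P := fun i => vectorVel (contactHam n h) 0
        (Y + s • Y (tIdx n) • vec (-b) a 0) i = (Y (tIdx n) • (vec (-b) a 0 : Vc n)) i)
        (fun k => ?_) (fun k => ?_) ?_ i
      · rw [hh, vectorVel_quad_p, ← hh]
        simp [hpd, dotProduct_coord]
      · rw [hh, vectorVel_quad_q, ← hh]
        simp [hpd, dotProduct_coord]
      · rw [hh, vectorVel_quad_t, ← hh]
        simp [hpd]
        simp [hh, fderiv_quad]
  · intro s
    rw [divergence_contactHam hd]
    simp [hpd]

theorem transvection_invariant (hQ : Differentiable ℝ (unc Q))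
    (hinv : ∀ h : Vc n → ℝ, ContDiff ℝ (⊤ : ℕ∞) h →
      ∀ x ξ η Y, LAct3 n ν (contactHam n h) Q x ξ η Y = 0) (a b : Fin n → ℝ) (τ : ℝ)
    (ξ η : Vc n) (y : ℝ) :
    Q 0 (ξ + (τ * ∑ k, (a k * ξ (qIdx n k) - b k * ξ (pIdx n k))) • vec a b 0)
      (η + (τ * ∑ k, (a k * η (qIdx n k) - b k * η (pIdx n k))) • vec a b 0)
      (vec 0 0 y) = Q 0 ξ η (vec 0 0 y) := by
  set h : Vc n → ℝ := quad 0 0 ((-τ / 2) • vec a b 0) (vec a b 0) with hh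
  have hd : ContDiff ℝ (⊤ : ℕ∞) h := contDiff_quad ..
  have hpd : ∀ j, pd j h 0 = 0 := by
    intro j
    simp [hh, pd_quad]
  have key := unc_eq_of_affine hQ (hinv _ hd) (p := ((0, ξ), (η, vec 0 0 y)))
    (v := ((0, (τ * ∑ k, (a k * ξ (qIdx n k) - b k * ξ (pIdx n k))) • vec a b 0),
      ((τ * ∑ k, (a k * η (qIdx n k) - b k * η (pIdx n k))) • vec a b 0, 0))) ?_ ?_ 1
  · simpa [unc] using key
  · intro s
    have hcov : ∀ (ζ : Vc n) (r : ℝ), covectorVel (contactHam n h) 0 (ζ + r • vec a b 0)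
        = (τ * ∑ k, (a k * ζ (qIdx n k) - b k * ζ (pIdx n k))) • vec a b 0 := by
      intro ζ r
      have e : (vec a b 0 : Vc n) ⬝ᵥ twist 0 (ζ + r • vec a b 0)
          = ∑ k, (a k * ζ (qIdx n k) - b k * ζ (pIdx n k)) := by
        simp only [dotProduct_coord, twist, vec_p, vec_q, vec_t, ← Finset.sum_add_distrib,
          Pi.add_apply, Pi.smul_apply, Pi.zero_apply, smul_eq_mul, zero_mul, add_zero, mul_zero]
        exact Finset.sum_congr rfl fun k _ => by ring
      rw [hh, covectorVel_quad, ← hh]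
      simp only [hpd, smul_dotProduct, e]
      funext j
      simp
      ring
    refine Prod.ext (Prod.ext ?_ ?_) (Prod.ext ?_ ?_)
    · funext i
      simp only [lift, Prod.fst_add, Prod.smul_fst, zero_add, smul_zero]
      refine coord_cases (P := fun i => contactHam n h 0 i = (0 : Vc n) i)
        (fun k => ?_) (fun k => ?_) ?_ i
      · simp [contactHam_p, hpd]
      · simp [contactHam_q, hpd]
      · simp [contactHam_t, hh, quad]
    · simpa [lift, smul_smul] using hcov ξ _
    · simpa [lift, smul_smul] using hcov η _
    · funext i
      simp only [lift, Prod.fst_add, Prod.snd_add, Prod.smul_fst, Prod.smul_snd, smul_zero,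
        add_zero]
      refine coord_cases (P := fun i => vectorVel (contactHam n h) 0 (vec 0 0 y) i = (0 : Vc n) i)
        (fun k => ?_) (fun k => ?_) ?_ i
      · rw [hh, vectorVel_quad_p, ← hh]
        simp [hpd, dotProduct_coord]
      · rw [hh, vectorVel_quad_q, ← hh]
        simp [hpd, dotProduct_coord]
      · rw [hh, vectorVel_quad_t, ← hh]
        simp [hpd]
        simp [hh, fderiv_quad]
  · intro s
    rw [divergence_contactHam hd]
    simp [hpd]

end Moves

theorem eq_exp_mul_of_hasDerivAt {f : ℝ → ℝ} {c : ℝ} (hf : ∀ s, HasDerivAt f (c * f s) s) (s : ℝ) :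
    f s = Real.exp (c * s) * f 0 := by
  have hd : ∀ s, HasDerivAt (fun r => Real.exp (-(c * r)) * f r) 0 s := by
    intro s
    have h := (((hasDerivAt_id s).const_mul c).neg.exp).mul (hf s)
    refine h.congr_deriv ?_
    simp
    ring
  have h := is_const_of_deriv_eq_zero (fun s => (hd s).differentiableAt) (fun s => (hd s).deriv) s 0
  simp only [mul_zero, neg_zero, Real.exp_zero, one_mul] at h
  rw [← h, ← mul_assoc, ← Real.exp_add]
  simp

theorem dilation_scales {n : ℕ} {ν : ℝ} {Q : Vc n → Vc n → Vc n → Vc n → ℝ}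
    (hQ : Differentiable ℝ (unc Q))
    (hinv : ∀ h : Vc n → ℝ, ContDiff ℝ (⊤ : ℕ∞) h →
      ∀ x ξ η Y, LAct3 n ν (contactHam n h) Q x ξ η Y = 0) (k₀ : Fin n) (s τ : ℝ) :
    Q 0 (vec (Pi.single k₀ s) 0 0 + Real.exp (2 * τ) • vec 0 0 1)
      (Real.exp (2 * τ) • vec 0 (Pi.single k₀ 1) 1) (Real.exp (-2 * τ) • vec 0 0 1)
      = Real.exp ((2 * n + 2) * ν * τ)
        * Q 0 (vec (Pi.single k₀ s) 0 0 + vec 0 0 1) (vec 0 (Pi.single k₀ 1) 1) (vec 0 0 1) := by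
  set h : Vc n → ℝ := quad 0 (vec 0 0 1) (vec (Pi.single k₀ 1) 0 0) (-vec 0 (Pi.single k₀ 1) 0)
    with hh
  have hd : ContDiff ℝ (⊤ : ℕ∞) h := contDiff_quad ..
  have hpd : ∀ j, pd j h 0 = (vec 0 0 1 : Vc n) j := by
    intro j
    simp [hh, pd_quad]
  have hcov : ∀ ζ : Vc n, covectorVel (contactHam n h) 0 ζ
      = vec (-Pi.single k₀ (ζ (pIdx n k₀))) (Pi.single k₀ (ζ (qIdx n k₀))) (ζ (tIdx n)) + ζ := by
    intro ζ
    rw [hh, covectorVel_quad, ← hh]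
    simp only [hpd]
    funext i
    refine coord_cases (P := fun i => _ = _) (fun k => ?_) (fun k => ?_) ?_ i
    · simp [dotProduct_coord, twist, Pi.single_apply]
    · simp [dotProduct_coord, twist, Pi.single_apply]
    · simp [dotProduct_coord, twist]
  let γ : ℝ → Tot n := fun τ =>
    ((0, vec (Pi.single k₀ s) 0 0 + Real.exp (2 * τ) • vec 0 0 1),
      (Real.exp (2 * τ) • vec 0 (Pi.single k₀ 1) 1, Real.exp (-2 * τ) • vec 0 0 1))
  have hexp : ∀ c τ : ℝ, HasDerivAt (fun τ => Real.exp (c * τ)) (c * Real.exp (c * τ)) τ := by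
    intro c τ
    simpa [mul_comm] using ((hasDerivAt_id τ).const_mul c).exp
  have hγ : ∀ τ, HasDerivAt γ (lift (contactHam n h) (γ τ)) τ := by
    intro τ
    refine (((hasDerivAt_const τ (0 : Vc n)).prodMk
      (((hexp 2 τ).smul_const (vec 0 0 1 : Vc n)).const_add (vec (Pi.single k₀ s) 0 0))).prodMk
      (((hexp 2 τ).smul_const (vec 0 (Pi.single k₀ 1) 1 : Vc n)).prodMk
        ((hexp (-2) τ).smul_const (vec 0 0 1 : Vc n)))).congr_deriv ?_
    refine Prod.ext (Prod.ext ?_ ?_) (Prod.ext ?_ ?_)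
    · funext i
      refine coord_cases (P := fun i => (0 : Vc n) i = contactHam n h 0 i)
        (fun k => ?_) (fun k => ?_) ?_ i
      · simp [contactHam_p, hpd]
      · simp [contactHam_q, hpd]
      · simp [contactHam_t, hh, quad]
    · simp only [γ, lift, hcov]
      funext i
      refine coord_cases (P := fun i => _ = _) (fun k => ?_) (fun k => ?_) ?_ i
      · simp
      · simp
      · simp
        ring
    · simp only [γ, lift, hcov]
      funext i
      refine coord_cases (P := fun i => _ = _) (fun k => ?_) (fun k => ?_) ?_ i
      · simp
      · simp [Pi.single_apply]
        split_ifs <;> ring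
      · simp
        ring
    · simp only [γ, lift]
      funext i
      refine coord_cases (P := fun i => _ = _) (fun k => ?_) (fun k => ?_) ?_ i
      · rw [hh, vectorVel_quad_p]
        simp [dotProduct_coord]
      · rw [hh, vectorVel_quad_q]
        simp [dotProduct_coord]
      · rw [hh, vectorVel_quad_t]
        simp [fderiv_quad, dotProduct_coord]
  have key := eq_exp_mul_of_hasDerivAt (f := fun τ => unc Q (γ τ)) (c := (2 * n + 2) * ν)
    (fun τ => (hasDerivAt_unc_comp hQ (hinv h hd) (hγ τ)).congr_deriv (by
      rw [divergence_contactHam hd, show (γ τ).1.1 = 0 from rfl, hpd, vec_t]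
      ring)) τ
  simpa [γ, unc] using key

/-- A smooth function on the line which is homogeneous under positive dilations is a monomial. -/
theorem exists_eq_mul_pow_of_homogeneous {ψ : ℝ → ℝ} {r : ℝ} (hψ : ContDiff ℝ (⊤ : ℕ∞) ψ)
    (h : ∀ μ : ℝ, 0 < μ → ∀ s, ψ (μ * s) = μ ^ r * ψ s) :
    ∃ (C : ℝ) (f : ℕ), (∀ s, ψ s = C * s ^ f) ∧ (C ≠ 0 → (f : ℝ) = r) := by
  obtain ⟨N, hN⟩ := exists_nat_gt r
  induction N generalizing ψ r with
  | zero =>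
    rw [Nat.cast_zero] at hN
    refine ⟨0, 0, fun s => ?_, fun h => absurd rfl h⟩
    have h₁ : Filter.Tendsto (fun μ : ℝ => μ ^ (-r) * ψ (μ * s)) (nhdsWithin 0 (Set.Ioi 0))
        (nhds ((0 : ℝ) ^ (-r) * ψ (0 * s))) := by
      refine Filter.Tendsto.mono_left ?_ nhdsWithin_le_nhds
      refine (Real.continuousAt_rpow_const 0 (-r) (Or.inr (by linarith))).mul ?_
      exact (hψ.continuous.comp (by fun_prop : Continuous fun μ : ℝ => μ * s)).continuousAt
    have h₂ : Filter.Tendsto (fun μ : ℝ => μ ^ (-r) * ψ (μ * s)) (nhdsWithin 0 (Set.Ioi 0))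
        (nhds (ψ s)) := by
      refine tendsto_const_nhds.congr' ?_
      filter_upwards [self_mem_nhdsWithin] with μ hμ
      rw [h μ hμ, ← mul_assoc, ← Real.rpow_add hμ]
      simp
    rw [tendsto_nhds_unique h₂ h₁, Real.zero_rpow (by linarith)]
    simp
  | succ N ih =>
    have hd : Differentiable ℝ ψ := hψ.differentiable (by simp)
    have hscale : ∀ μ : ℝ, 0 < μ → ∀ s, deriv ψ (μ * s) = μ ^ (r - 1) * deriv ψ s := by
      intro μ hμ s
      have e₁ : HasDerivAt (fun s => ψ (μ * s)) (deriv ψ (μ * s) * μ) s :=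
        ((hd (μ * s)).hasDerivAt.comp s ((hasDerivAt_id s).const_mul μ)).congr_deriv
          (by rw [mul_one])
      have e₂ : HasDerivAt (fun s => ψ (μ * s)) (μ ^ r * deriv ψ s) s :=
        ((hd s).hasDerivAt.const_mul (μ ^ r)).congr_of_eventuallyEq
          (Filter.Eventually.of_forall (h μ hμ))
      rw [Real.rpow_sub_one hμ.ne', div_mul_eq_mul_div, ← e₁.unique e₂,
        mul_div_cancel_right₀ _ hμ.ne']
    have euler : ∀ s, s * deriv ψ s = r * ψ s := by
      intro s
      have e₁ : HasDerivAt (fun μ : ℝ => ψ (μ * s)) (deriv ψ (1 * s) * s) 1 :=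
        ((hd (1 * s)).hasDerivAt.comp 1 ((hasDerivAt_id (1 : ℝ)).mul_const s)).congr_deriv
          (by rw [one_mul s])
      have e₂ : HasDerivAt (fun μ : ℝ => ψ (μ * s)) (r * (1 : ℝ) ^ (r - 1) * ψ s) 1 := by
        refine ((Real.hasDerivAt_rpow_const
          (Or.inl one_ne_zero)).mul_const (ψ s)).congr_of_eventuallyEq ?_
        filter_upwards [lt_mem_nhds (zero_lt_one' ℝ)] with μ hμ using h μ hμ s
      have e := e₁.unique e₂
      rw [one_mul, Real.one_rpow, mul_one] at e
      rw [← e, mul_comm]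
    obtain ⟨C, f, hC, hf⟩ := ih (contDiff_infty_iff_deriv.1 hψ).2 hscale
      (by push_cast at hN; linarith)
    by_cases hr : r = 0
    · have hC₀ : C = 0 := by
        by_contra hne
        have := hf hne
        have : (0 : ℝ) ≤ f := Nat.cast_nonneg f
        linarith
      refine ⟨ψ 0, 0, fun s => ?_, fun _ => by simp [hr]⟩
      rw [pow_zero, mul_one]
      exact is_const_of_deriv_eq_zero hd (fun s => by rw [hC, hC₀, zero_mul]) s 0
    · refine ⟨C / r, f + 1, fun s => ?_, fun hne => ?_⟩
      · have := euler s
        rw [hC] at this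
        field_simp
        linear_combination -this
      · have hC₀ : C ≠ 0 := fun h₀ => hne (by rw [h₀, zero_div])
        push_cast
        linarith [hf hC₀]

/-- The values of `Q` at the reference points over the origin form a monomial. -/
theorem exists_eq_mul_pow_of_invariant {n k m l : ℕ} {ν : ℝ}
    {Q : Vc n → Vc n → Vc n → Vc n → ℝ} (hQ : InS n k m l Q)
    (hinv : ∀ h : Vc n → ℝ, ContDiff ℝ (⊤ : ℕ∞) h →
      ∀ x ξ η Y, LAct3 n ν (contactHam n h) Q x ξ η Y = 0) (k₀ : Fin n) :
    ∃ (C : ℝ) (f : ℕ),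
      (∀ s, Q 0 (vec (Pi.single k₀ s) 0 1) (vec 0 (Pi.single k₀ 1) 1) (vec 0 0 1) = C * s ^ f) ∧
      (C ≠ 0 → (f : ℝ) = k + m - l - (n + 1) * ν) := by
  obtain ⟨hsm, hξ, hη, hY⟩ := hQ
  have hvec : ∀ s, (vec (Pi.single k₀ s) 0 1 : Vc n)
      = s • vec (Pi.single k₀ 1) 0 0 + vec 0 0 1 := by
    intro s
    funext i
    refine coord_cases (P := fun i => _ = _) (fun k => ?_) (fun k => ?_) ?_ i <;>
      simp [Pi.single_apply]
  refine exists_eq_mul_pow_of_homogeneous ?_ ?_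
  · simp only [hvec]
    exact hsm.comp (by fun_prop : ContDiff ℝ (⊤ : ℕ∞) fun s : ℝ =>
      (((0, s • vec (Pi.single k₀ 1) 0 0 + vec 0 0 1),
        (vec 0 (Pi.single k₀ 1) 1, vec 0 0 1)) : Tot n))
  · intro μ hμ s
    have key := dilation_scales (hsm.differentiable (by simp)) hinv k₀ s (-(Real.log μ / 2))
    have e₁ : Real.exp (2 * -(Real.log μ / 2)) = μ⁻¹ := by
      rw [mul_neg, mul_div_cancel₀ _ two_ne_zero, Real.exp_neg, Real.exp_log hμ]
    have e₂ : Real.exp (-2 * -(Real.log μ / 2)) = μ := by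
      rw [neg_mul_neg, mul_div_cancel₀ _ two_ne_zero, Real.exp_log hμ]
    have e₃ : Real.exp ((2 * n + 2) * ν * -(Real.log μ / 2)) = μ ^ (-((n + 1) * ν)) := by
      rw [Real.rpow_def_of_pos hμ]
      congr 1
      ring
    have hv : ∀ (a b : Fin n → ℝ) (c : ℝ), (vec a b 0 : Vc n) + c • vec 0 0 1 = vec a b c := by
      intro a b c
      funext i
      refine coord_cases (P := fun i => _ = _) (fun k => ?_) (fun k => ?_) ?_ i <;> simp
    have hs : (vec (Pi.single k₀ s) 0 μ⁻¹ : Vc n) = μ⁻¹ • vec (Pi.single k₀ (μ * s)) 0 1 := by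
      funext i
      refine coord_cases (P := fun i => _ = _) (fun k => ?_) (fun k => ?_) ?_ i
      · simp [Pi.single_apply, hμ.ne']
      · simp
      · simp
    have h₁ : (vec (Pi.single k₀ s) 0 0 : Vc n) + vec 0 0 1 = vec (Pi.single k₀ s) 0 1 := by
      simpa using hv (Pi.single k₀ s) 0 1
    rw [e₁, e₂, e₃, hv, h₁, hs, hξ, hη, hY] at key
    rw [show (k + m - l - (n + 1) * ν : ℝ) = k + m + -l + -((n + 1) * ν) by ring,
      Real.rpow_add hμ, mul_assoc, ← key, Real.rpow_add hμ, Real.rpow_add hμ, Real.rpow_neg hμ.le]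
    simp only [Real.rpow_natCast, inv_pow]
    field_simp

section Transvections

variable {V : Type*} [AddCommGroup V] [Module ℝ V] {B : V →ₗ[ℝ] V →ₗ[ℝ] ℝ} {F : V → V → ℝ}

theorem transvection_invariant_right (hB : B.IsAlt)
    (hF : ∀ v τ ξ η, F (ξ + (τ * B v ξ) • v) (η + (τ * B v η) • v) = F ξ η) {ξ η η' : V}
    (h : B ξ η = B ξ η') (h₀ : B ξ η ≠ 0) : F ξ η = F ξ η' := by
  have step : ∀ η : V, B ξ η = B ξ η' → B η η' ≠ 0 → F ξ η = F ξ η' := by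
    intro η h h₁
    have e₁ : B (η' - η) ξ = 0 := by
      rw [← hB.neg, map_sub, h]
      simp
    have e₂ : (B η' η)⁻¹ * B (η' - η) η = 1 := by
      rw [map_sub, LinearMap.sub_apply, hB.self_eq_zero, sub_zero]
      refine inv_mul_cancel₀ ?_
      rwa [← hB.neg, neg_ne_zero]
    have := hF (η' - η) (B η' η)⁻¹ ξ η
    rw [e₁, e₂] at this
    simpa using this.symm
  by_cases h₁ : B η η' = 0
  · have := hF ξ (B ξ η)⁻¹ ξ η
    rw [hB.self_eq_zero, inv_mul_cancel₀ h₀, mul_zero, zero_smul, add_zero, one_smul] at this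
    rw [← this]
    refine step _ ?_ ?_
    · rw [map_add, hB.self_eq_zero, add_zero, h]
    · rw [map_add, LinearMap.add_apply, h₁, zero_add, ← h]
      exact h₀
  · exact step η h h₁

/-- Functions of two vectors invariant under symplectic transvections only depend on the
symplectic pairing of the vectors. -/
theorem eq_of_transvection_invariant (hB : B.IsAlt)
    (hF : ∀ v τ ξ η, F (ξ + (τ * B v ξ) • v) (η + (τ * B v η) • v) = F ξ η) {ξ η ξ' η' : V}
    (h : B ξ η = B ξ' η') (h₀ : B ξ η ≠ 0) (h₁ : B ξ ξ' ≠ 0) : F ξ η = F ξ' η' := by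
  have hne : B ξ' ξ ≠ 0 := by rwa [← hB.neg, neg_ne_zero]
  have e₁ : (B ξ' ξ)⁻¹ * B (ξ' - ξ) ξ = 1 := by
    rw [map_sub, LinearMap.sub_apply, hB.self_eq_zero, sub_zero, inv_mul_cancel₀ hne]
  have key := hF (ξ' - ξ) (B ξ' ξ)⁻¹ ξ η
  rw [e₁, one_smul, add_sub_cancel] at key
  rw [← key]
  have e₂ : B ξ' (η + ((B ξ' ξ)⁻¹ * B (ξ' - ξ) η) • (ξ' - ξ)) = B ξ η := by
    simp only [map_add, map_smul, map_sub, LinearMap.sub_apply, hB.self_eq_zero, smul_eq_mul]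
    field_simp
    ring
  exact transvection_invariant_right hB hF (e₂.trans h) (e₂.trans_ne h₀)

end Transvections

/-- The standard symplectic form on `ℝⁿ × ℝⁿ`. -/
def symplecticForm (n : ℕ) :
    ((Fin n → ℝ) × (Fin n → ℝ)) →ₗ[ℝ] ((Fin n → ℝ) × (Fin n → ℝ)) →ₗ[ℝ] ℝ :=
  LinearMap.mk₂ ℝ (fun v w => ∑ k, (v.1 k * w.2 k - v.2 k * w.1 k))
    (fun u v w => by
      rw [← Finset.sum_add_distrib]
      exact Finset.sum_congr rfl fun k _ => by simp; ring)
    (fun c v w => by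
      rw [smul_eq_mul, Finset.mul_sum]
      exact Finset.sum_congr rfl fun k _ => by simp; ring)
    (fun u v w => by
      rw [← Finset.sum_add_distrib]
      exact Finset.sum_congr rfl fun k _ => by simp; ring)
    (fun c v w => by
      rw [smul_eq_mul, Finset.mul_sum]
      exact Finset.sum_congr rfl fun k _ => by simp; ring)

theorem symplecticForm_apply {n : ℕ} (v w : (Fin n → ℝ) × (Fin n → ℝ)) :
    symplecticForm n v w = ∑ k, (v.1 k * w.2 k - v.2 k * w.1 k) := rfl

theorem symplecticForm_isAlt (n : ℕ) : (symplecticForm n).IsAlt := by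
  intro v
  rw [symplecticForm_apply]
  exact Finset.sum_eq_zero fun k _ => by ring

theorem smul_vec {n : ℕ} (r : ℝ) (a b : Fin n → ℝ) (c : ℝ) :
    r • vec a b c = vec (r • a) (r • b) (r * c) := by
  funext i
  refine coord_cases (P := fun i => _ = _) (fun k => ?_) (fun k => ?_) ?_ i <;> simp

theorem vec_add_vec {n : ℕ} (a b a' b' : Fin n → ℝ) (c c' : ℝ) :
    vec a b c + vec a' b' c' = vec (a + a') (b + b') (c + c') := by
  funext i
  refine coord_cases (P := fun i => _ = _) (fun k => ?_) (fun k => ?_) ?_ i <;> simp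

/-- Over the origin, an invariant is determined on an open dense set by its values at the
reference points. -/
theorem eq_of_reference_values {n k m l : ℕ} {ν : ℝ} {Q : Vc n → Vc n → Vc n → Vc n → ℝ}
    (hQ : InS n k m l Q)
    (hinv : ∀ h : Vc n → ℝ, ContDiff ℝ (⊤ : ℕ∞) h →
      ∀ x ξ η Y, LAct3 n ν (contactHam n h) Q x ξ η Y = 0) (k₀ : Fin n) {C : ℝ} {f : ℕ}
    (hC : ∀ s, Q 0 (vec (Pi.single k₀ s) 0 1) (vec 0 (Pi.single k₀ 1) 1) (vec 0 0 1) = C * s ^ f)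
    {ξ η Y : Vc n} (hξ₀ : ξ (qIdx n k₀) ≠ 0) (hY₀ : Y (tIdx n) ≠ 0) (hL : L1p n 0 ξ η Y ≠ 0)
    (h₁ : u1 n 0 ξ η Y ≠ 0) (h₂ : u2 n 0 ξ η Y ≠ 0) :
    Q 0 ξ η Y * u1 n 0 ξ η Y ^ f * u2 n 0 ξ η Y ^ f * Y (tIdx n) ^ (k + m)
      = C * u1 n 0 ξ η Y ^ k * u2 n 0 ξ η Y ^ m * Y (tIdx n) ^ (l + 2 * f)
        * L1p n 0 ξ η Y ^ f := by
  obtain ⟨hsm, hξ, hη, hY⟩ := hQ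
  have hdiff : Differentiable ℝ (unc Q) := hsm.differentiable (by simp)
  set T := Y (tIdx n) with hT
  set L := L1p n 0 ξ η Y with hLdef
  set x := u1 n 0 ξ η Y / T with hx
  set y := u2 n 0 ξ η Y / T with hy
  have hx₀ : x ≠ 0 := div_ne_zero h₁ hY₀
  have hy₀ : y ≠ 0 := div_ne_zero h₂ hY₀
  have hshear : ∀ ζ : Vc n, ζ - (∑ k, ((-Y (qIdx n k) / T) * ζ (qIdx n k)
      - (Y (pIdx n k) / T) * ζ (pIdx n k))) • vec 0 0 1
      = vec (fun k => ζ (pIdx n k)) (fun k => ζ (qIdx n k)) ((∑ i, Y i * ζ i) / T) := by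
    intro ζ
    funext i
    refine coord_cases (P := fun i => _ = _) (fun k => by simp) (fun k => by simp) ?_ i
    simp only [Pi.sub_apply, Pi.smul_apply, vec_t, smul_eq_mul, mul_one, sum_coord, ← hT, add_div,
      mul_div_cancel_left₀ _ hY₀, Finset.sum_sub_distrib, Finset.sum_div, neg_div, neg_mul,
      Finset.sum_neg_distrib, div_mul_eq_mul_div]
    ring
  have hYvec : Y + T • vec (-fun k => Y (pIdx n k) / T) (fun k => -Y (qIdx n k) / T) 0
      = vec 0 0 T := by
    funext i
    refine coord_cases (P := fun i => _ = _) (fun k => ?_) (fun k => ?_) ?_ i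
    · simp [mul_div_cancel₀ _ hY₀]
    · simp [mul_div_cancel₀ _ hY₀]
    · simp [hT]
  have key₁ := shear_invariant hdiff hinv (fun k => -Y (qIdx n k) / T) (fun k => Y (pIdx n k) / T)
    ξ η Y
  rw [hshear, hshear, hYvec] at key₁
  let F : ((Fin n → ℝ) × (Fin n → ℝ)) → ((Fin n → ℝ) × (Fin n → ℝ)) → ℝ := fun v w =>
    Q 0 (vec v.1 v.2 x) (vec w.1 w.2 y) (vec 0 0 T)
  have hF : ∀ v τ ξ η, F (ξ + (τ * symplecticForm n v ξ) • v) (η + (τ * symplecticForm n v η) • v)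
      = F ξ η := by
    intro v τ ξ η
    have := transvection_invariant hdiff hinv v.1 v.2 τ (vec ξ.1 ξ.2 x) (vec η.1 η.2 y) T
    simp only [vec_p, vec_q, smul_vec, vec_add_vec, mul_zero, add_zero] at this
    exact this
  have hpair : symplecticForm n (fun k => ξ (pIdx n k), fun k => ξ (qIdx n k))
      (fun k => η (pIdx n k), fun k => η (qIdx n k)) = L := by
    simp [symplecticForm_apply, hLdef, L1p]
  have key₂ : F (fun k => ξ (pIdx n k), fun k => ξ (qIdx n k))
      (fun k => η (pIdx n k), fun k => η (qIdx n k))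
      = F (Pi.single k₀ (L / y), 0) (0, Pi.single k₀ y) := by
    refine eq_of_transvection_invariant (symplecticForm_isAlt n) hF ?_ ?_ ?_
    · rw [hpair, symplecticForm_apply]
      simp [Pi.single_apply, hy₀]
    · rwa [hpair]
    · rw [symplecticForm_apply]
      simp [Pi.single_apply, hy₀, hL, hξ₀]
  have key₃ : F (Pi.single k₀ (L / y), 0) (0, Pi.single k₀ y)
      = x ^ k * (y ^ m * (T ^ l * (C * (L / (x * y)) ^ f))) := by
    rw [← hC, ← hY, ← hη, ← hξ]
    simp only [F, smul_vec, smul_zero, mul_one, ← Pi.single_smul, smul_eq_mul]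
    congr 4
    field_simp
  have key : Q 0 ξ η Y = x ^ k * (y ^ m * (T ^ l * (C * (L / (x * y)) ^ f))) := by
    rw [← key₃, ← key₂, ← key₁]
    rfl
  have e₁ : u1 n 0 ξ η Y = x * T := (div_mul_cancel₀ _ hY₀).symm
  have e₂ : u2 n 0 ξ η Y = y * T := (div_mul_cancel₀ _ hY₀).symm
  rw [key, e₁, e₂, div_pow L, mul_pow x y]
  field_simp
  ring

theorem dense_ne_zero_of_analytic {E : Type*} [NormedAddCommGroup E] [NormedSpace ℝ E] {P : E → ℝ}
    (hP : AnalyticOnNhd ℝ P Set.univ) {z₀ : E} (h₀ : P z₀ ≠ 0) : Dense {z | P z ≠ 0} := by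
  intro z
  rw [mem_closure_iff_frequently]
  intro hz
  have hev : P =ᶠ[nhds z] 0 := hz.mono fun y hy => not_not.1 hy
  exact h₀ (hP.eqOn_zero_of_preconnected_of_eventuallyEq_zero isPreconnected_univ
    (Set.mem_univ z) hev (Set.mem_univ z₀))

theorem le_of_mul_pow_eq {E : Type*} [TopologicalSpace E] {u A B : E → ℝ} {a b : ℕ}
    (hu : Continuous u) (hA : Continuous A) (hB : Continuous B) (hd : Dense {z | u z ≠ 0})
    (h : ∀ z, A z * u z ^ a = B z * u z ^ b) {z₁ : E} (hu₁ : u z₁ = 0) (hB₁ : B z₁ ≠ 0) :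
    a ≤ b := by
  by_contra hlt
  have e : (fun z => A z * u z ^ (a - b)) = B := by
    refine (hA.mul (hu.pow _)).ext_on hd hB fun z hz => ?_
    have hz : u z ≠ 0 := hz
    refine mul_right_cancel₀ (pow_ne_zero b hz) ?_
    change A z * u z ^ (a - b) * u z ^ b = _
    rw [← h z, mul_assoc, ← pow_add, Nat.sub_add_cancel (by omega)]
  refine hB₁ ?_
  rw [← e]
  simp only [hu₁, zero_pow (by omega : a - b ≠ 0), mul_zero]

section Origin

variable {n : ℕ}

theorem u1_vec (x η : Vc n) (a b a' b' : Fin n → ℝ) (c c' : ℝ) :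
    u1 n x (vec a b c) η (vec a' b' c') = ∑ k, a' k * a k + ∑ k, b' k * b k + c' * c := by
  simp [u1, sum_coord]

theorem u2_vec (x ξ : Vc n) (a b a' b' : Fin n → ℝ) (c c' : ℝ) :
    u2 n x ξ (vec a b c) (vec a' b' c') = ∑ k, a' k * a k + ∑ k, b' k * b k + c' * c := by
  simp [u2, sum_coord]

theorem L1p_zero_vec (Y : Vc n) (a b a' b' : Fin n → ℝ) (c c' : ℝ) :
    L1p n 0 (vec a b c) (vec a' b' c') Y = ∑ k, (a k * b' k - b k * a' k) := by
  simp [L1p]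

/-- Over the origin, an invariant is a multiple of a single monomial. -/
theorem exists_monomial_of_invariant {k m l : ℕ} {ν : ℝ}
    {Q : Vc n → Vc n → Vc n → Vc n → ℝ} (hQ : InS n k m l Q)
    (hinv : ∀ h : Vc n → ℝ, ContDiff ℝ (⊤ : ℕ∞) h →
      ∀ x ξ η Y, LAct3 n ν (contactHam n h) Q x ξ η Y = 0) (k₀ : Fin n) :
    ∃ (C : ℝ) (a b c f : ℕ),
      (C ≠ 0 → a + f = k ∧ b + f = m ∧ a + b + c = l ∧ (f : ℝ) - c = (n + 1) * ν) ∧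
      ∀ ξ η Y, Q 0 ξ η Y
        = C * u1 n 0 ξ η Y ^ a * u2 n 0 ξ η Y ^ b * Y (tIdx n) ^ c * L1p n 0 ξ η Y ^ f := by
  obtain ⟨C, f, hC, hf⟩ := exists_eq_mul_pow_of_invariant hQ hinv k₀
  let U₁ : Vc n × Vc n × Vc n → ℝ := fun z => u1 n 0 z.1 z.2.1 z.2.2
  let U₂ : Vc n × Vc n × Vc n → ℝ := fun z => u2 n 0 z.1 z.2.1 z.2.2
  let L : Vc n × Vc n × Vc n → ℝ := fun z => L1p n 0 z.1 z.2.1 z.2.2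
  let T : Vc n × Vc n × Vc n → ℝ := fun z => z.2.2 (tIdx n)
  let G : Vc n × Vc n × Vc n → ℝ := fun z => Q 0 z.1 z.2.1 z.2.2
  let P : Vc n × Vc n × Vc n → ℝ := fun z => z.1 (qIdx n k₀) * T z * L z * U₁ z * U₂ z
  have hPsmooth : ContDiff ℝ ⊤ P := by
    simp only [P, T, L, U₁, U₂, u1, u2, L1p]
    fun_prop
  have hU₁ : Continuous U₁ := by
    simp only [U₁, u1]
    fun_prop
  have hU₂ : Continuous U₂ := by
    simp only [U₂, u2]
    fun_prop
  have hL : Continuous L := by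
    simp only [L, L1p]
    fun_prop
  have hT : Continuous T := by fun_prop
  have hG : Continuous G := hQ.1.continuous.comp
    (by fun_prop : Continuous fun z : Vc n × Vc n × Vc n => (((0, z.1), (z.2.1, z.2.2)) : Tot n))
  have hdense : Dense {z | P z ≠ 0} := by
    refine dense_ne_zero_of_analytic (contDiff_omega_iff_analyticOnNhd.1 hPsmooth)
      (z₀ := (vec (Pi.single k₀ 1) (Pi.single k₀ 1) 0, vec 0 (Pi.single k₀ 1) 0,
        vec (Pi.single k₀ 1) (Pi.single k₀ 1) 1)) ?_
    simp [P, T, L, U₁, U₂, u1_vec, u2_vec, L1p_zero_vec, Pi.single_apply]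
  have key : ∀ z, G z * U₁ z ^ f * U₂ z ^ f * T z ^ (k + m)
      = C * U₁ z ^ k * U₂ z ^ m * T z ^ (l + 2 * f) * L z ^ f := by
    refine congrFun (Continuous.ext_on hdense (by fun_prop) (by fun_prop) fun z hz => ?_)
    have hz : z.1 (qIdx n k₀) * T z * L z * U₁ z * U₂ z ≠ 0 := hz
    simp only [mul_ne_zero_iff] at hz
    obtain ⟨⟨⟨⟨h₁, h₂⟩, h₃⟩, h₄⟩, h₅⟩ := hz
    exact eq_of_reference_values hQ hinv k₀ hC h₁ h₂ h₃ h₄ h₅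
  have hdU₁ : Dense {z | U₁ z ≠ 0} :=
    hdense.mono fun z (hz : P z ≠ 0) (h : U₁ z = 0) => hz (by simp [P, h])
  have hdU₂ : Dense {z | U₂ z ≠ 0} :=
    hdense.mono fun z (hz : P z ≠ 0) (h : U₂ z = 0) => hz (by simp [P, h])
  have hdT : Dense {z | T z ≠ 0} :=
    hdense.mono fun z (hz : P z ≠ 0) (h : T z = 0) => hz (by simp [P, h])
  by_cases hC₀ : C = 0
  · refine ⟨0, 0, 0, 0, 0, fun h => absurd rfl h, fun ξ η Y => ?_⟩
    have hG₀ : G = fun _ => 0 := by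
      refine hG.ext_on hdense continuous_const fun z hz => ?_
      have hz : z.1 (qIdx n k₀) * T z * L z * U₁ z * U₂ z ≠ 0 := hz
      simp only [mul_ne_zero_iff] at hz
      have := key z
      simpa [hC₀, hz] using this
    simpa using congrFun hG₀ (ξ, η, Y)
  · have hk : f ≤ k := by
      refine le_of_mul_pow_eq (A := fun z => G z * U₂ z ^ f * T z ^ (k + m))
        (B := fun z => C * U₂ z ^ m * T z ^ (l + 2 * f) * L z ^ f) hU₁ (by fun_prop)
        (by fun_prop) hdU₁ (fun z => by linear_combination key z)
        (z₁ := (vec (Pi.single k₀ 1) 0 0, vec 0 (Pi.single k₀ 1) 1, vec 0 0 1)) ?_ ?_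
      · simp [U₁, u1_vec]
      · simp [T, L, U₂, u2_vec, L1p_zero_vec, Pi.single_apply, hC₀]
    have hm : f ≤ m := by
      refine le_of_mul_pow_eq (A := fun z => G z * U₁ z ^ f * T z ^ (k + m))
        (B := fun z => C * U₁ z ^ k * T z ^ (l + 2 * f) * L z ^ f) hU₂ (by fun_prop)
        (by fun_prop) hdU₂ (fun z => by linear_combination key z)
        (z₁ := (vec (Pi.single k₀ 1) 0 1, vec 0 (Pi.single k₀ 1) 0, vec 0 0 1)) ?_ ?_
      · simp [U₂, u2_vec]
      · simp [T, L, U₁, u1_vec, L1p_zero_vec, Pi.single_apply, hC₀]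
    have hl : k + m ≤ l + 2 * f := by
      refine le_of_mul_pow_eq (A := fun z => G z * U₁ z ^ f * U₂ z ^ f)
        (B := fun z => C * U₁ z ^ k * U₂ z ^ m * L z ^ f) hT (by fun_prop)
        (by fun_prop) hdT (fun z => by linear_combination key z)
        (z₁ := (vec (Pi.single k₀ 1) 0 0, vec 0 (Pi.single k₀ 1) 0,
          vec (Pi.single k₀ 1) (Pi.single k₀ 1) 0)) ?_ ?_
      · simp [T]
      · simp [L, U₁, U₂, u1_vec, u2_vec, L1p_zero_vec, Pi.single_apply, hC₀]
    obtain ⟨a, rfl⟩ := Nat.exists_eq_add_of_le' hk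
    obtain ⟨b, rfl⟩ := Nat.exists_eq_add_of_le' hm
    obtain ⟨c, rfl⟩ : ∃ c, l = a + b + c := Nat.exists_eq_add_of_le (by omega)
    refine ⟨C, a, b, c, f, fun _ => ⟨rfl, rfl, rfl, ?_⟩, fun ξ η Y => ?_⟩
    · have := hf hC₀
      push_cast at this
      linarith
    · have hG' : G = fun z => C * U₁ z ^ a * U₂ z ^ b * T z ^ c * L z ^ f := by
        refine hG.ext_on hdense (by fun_prop) fun z hz => ?_
        have hz : z.1 (qIdx n k₀) * T z * L z * U₁ z * U₂ z ≠ 0 := hz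
        simp only [mul_ne_zero_iff] at hz
        obtain ⟨⟨⟨⟨-, h₂⟩, -⟩, h₄⟩, h₅⟩ := hz
        refine mul_right_cancel₀ (mul_ne_zero (mul_ne_zero (pow_ne_zero f h₄) (pow_ne_zero f h₅))
          (pow_ne_zero (a + f + (b + f)) h₂)) ?_
        linear_combination key z
      exact congrFun hG' (ξ, η, Y)

end Origin

/-- An invariant is a multiple of a single monomial. -/
theorem exists_eq_monomial_of_invariant {n k m l : ℕ} {ν : ℝ}
    {Q : Vc n → Vc n → Vc n → Vc n → ℝ} (hQ : InS n k m l Q)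
    (hinv : ∀ h : Vc n → ℝ, ContDiff ℝ (⊤ : ℕ∞) h →
      ∀ x ξ η Y, LAct3 n ν (contactHam n h) Q x ξ η Y = 0) (k₀ : Fin n) :
    ∃ (C : ℝ) (a b c f : ℕ),
      (C ≠ 0 → a + f = k ∧ b + f = m ∧ a + b + c = l ∧ (f : ℝ) - c = (n + 1) * ν) ∧
      ∀ x ξ η Y, Q x ξ η Y
        = C * u1 n x ξ η Y ^ a * u2 n x ξ η Y ^ b * u3 n x ξ η Y ^ c * L1p n x ξ η Y ^ f := by
  obtain ⟨C, a, b, c, f, hC, h⟩ := exists_monomial_of_invariant hQ hinv k₀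
  refine ⟨C * (-2) ^ c, a, b, c, f, fun hne => hC (left_ne_zero_of_mul hne), fun x ξ η Y => ?_⟩
  set g : Vc n := vec (fun k => x (qIdx n k)) (fun k => -x (pIdx n k)) 0 with hg
  have hgt : g (tIdx n) = 0 := vec_t ..
  have htr := translation_invariant (hQ.1.differentiable (by simp)) hinv x
    (ξ - ξ (tIdx n) • g) (η - η (tIdx n) • g) (Y + (Y ⬝ᵥ g) • vec 0 0 1)
  have hYg : (Y + (Y ⬝ᵥ g) • vec 0 0 1) ⬝ᵥ g = Y ⬝ᵥ g := by
    rw [add_dotProduct, smul_dotProduct]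
    simp [dotProduct_coord (vec 0 0 1), hgt]
  have hu : ∀ ζ : Vc n, (Y + (Y ⬝ᵥ g) • vec 0 0 1) ⬝ᵥ (ζ - ζ (tIdx n) • g) = Y ⬝ᵥ ζ := by
    intro ζ
    rw [dotProduct_sub, dotProduct_smul, hYg, add_dotProduct, smul_dotProduct]
    simp [dotProduct_coord (vec 0 0 1), mul_comm]
  have h₁ : u1 n 0 (ξ - ξ (tIdx n) • g) (η - η (tIdx n) • g) (Y + (Y ⬝ᵥ g) • vec 0 0 1)
      = u1 n x ξ η Y := hu ξ
  have h₂ : u2 n 0 (ξ - ξ (tIdx n) • g) (η - η (tIdx n) • g) (Y + (Y ⬝ᵥ g) • vec 0 0 1)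
      = u2 n x ξ η Y := hu η
  have h₃ : (Y + (Y ⬝ᵥ g) • vec 0 0 1 : Vc n) (tIdx n) = -2 * u3 n x ξ η Y := by
    simp only [u3, Pi.add_apply, Pi.smul_apply, vec_t, smul_eq_mul, mul_one, dotProduct_coord, hg,
      vec_p, vec_q, Finset.sum_sub_distrib, mul_neg, Finset.sum_neg_distrib, mul_comm (x _)]
    ring
  have h₄ : L1p n 0 (ξ - ξ (tIdx n) • g) (η - η (tIdx n) • g) (Y + (Y ⬝ᵥ g) • vec 0 0 1)
      = L1p n x ξ η Y := by
    simp only [L1p, Pi.sub_apply, Pi.smul_apply, hg, vec_p, vec_q, vec_t, smul_eq_mul,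
      Pi.zero_apply, zero_mul, add_zero, Finset.sum_const_zero, mul_zero, sub_zero, Finset.mul_sum,
      ← Finset.sum_add_distrib, ← Finset.sum_sub_distrib]
    exact Finset.sum_congr rfl fun k _ => by ring
  have hQx := h (ξ - ξ (tIdx n) • g) (η - η (tIdx n) • g) (Y + (Y ⬝ᵥ g) • vec 0 0 1)
  rw [h₁, h₂, h₃, h₄, ← htr, ← hg, hYg] at hQx
  simp only [Pi.sub_apply, Pi.smul_apply, hgt, smul_zero, sub_zero, sub_add_cancel,
    add_sub_cancel_right] at hQx
  rw [hQx, mul_pow]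
  ring
/-- `Q ∈ S^{km}_{ℓ;ν}` is invariant under all contact vector fields of `(ℝ^{2n+1},α)` iff
it is a linear combination of the monomials `u_1^a u_2^b u_3^c L_1^f` over the solutions
of `a+f = k`, `b+f = m`, `a+b+c = ℓ`, `f−c = (n+1)ν`. -/
theorem stmt15 (n : ℕ) (hn : 1 ≤ n) (k m l : ℕ) (ν : ℝ)
    (Q : Vc n → Vc n → Vc n → Vc n → ℝ) (hQ : InS n k m l Q) :
    (∀ h : Vc n → ℝ, ContDiff ℝ (⊤ : ℕ∞) h →
      ∀ x ξ η Y, LAct3 n ν (contactHam n h) Q x ξ η Y = 0)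
    ↔ ∃ co : ℕ → ℕ → ℕ → ℕ → ℝ,
        (∀ a b c f : ℕ, co a b c f ≠ 0 →
          a + f = k ∧ b + f = m ∧ a + b + c = l ∧
          (f : ℝ) - (c : ℝ) = ((n : ℝ)+1) * ν) ∧
        ∀ x ξ η Y, Q x ξ η Y =
          ∑ a ∈ Finset.range (k+1), ∑ b ∈ Finset.range (m+1), ∑ c ∈ Finset.range (l+1),
          ∑ f ∈ Finset.range (k+1),
            co a b c f * u1 n x ξ η Y ^ a * u2 n x ξ η Y ^ b * u3 n x ξ η Y ^ c
              * L1p n x ξ η Y ^ f := by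
  refine ⟨fun hinv => ?_, fun ⟨co, hco, hsum⟩ h hh => ?_⟩
  · obtain ⟨C, a, b, c, f, hC, hmon⟩ := exists_eq_monomial_of_invariant hQ hinv ⟨0, hn⟩
    by_cases hC₀ : C = 0
    · refine ⟨fun _ _ _ _ => 0, fun _ _ _ _ h => absurd rfl h, fun x ξ η Y => ?_⟩
      simp [hmon, hC₀]
    · obtain ⟨rfl, rfl, rfl, hν⟩ := hC hC₀
      refine ⟨fun a' b' c' f' => if a' = a ∧ b' = b ∧ c' = c ∧ f' = f then C else 0, ?_, ?_⟩
      · intro a' b' c' f' hne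
        obtain ⟨rfl, rfl, rfl, rfl⟩ : a' = a ∧ b' = b ∧ c' = c ∧ f' = f := by
          by_contra h
          exact hne (if_neg h)
        exact ⟨rfl, rfl, rfl, hν⟩
      · intro x ξ η Y
        rw [hmon, Finset.sum_eq_single_of_mem a (by simp),
          Finset.sum_eq_single_of_mem b (by simp),
          Finset.sum_eq_single_of_mem c (by simp),
          Finset.sum_eq_single_of_mem f (by simp)]
        · simp
        · intro f' _ hf'
          simp [hf']
        · intro c' _ hc'
          simp [hc']
        · intro b' _ hb'
          simp [hb']
        · intro a' _ ha'
          simp [ha']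
  · exact invariant_of_eq_sum (hQ.1.differentiable (by simp))
      (fun a b c f hne => (hco a b c f hne).2.2.2) hsum hh
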